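/- Let I be a finite poset with no source. Then 𝒫 equals the set of positive definite matrices belonging to ℋ; in particular, if X, Y ∈ 𝒫 then X+Y ∈ 𝒫. -/

import Mathlib

open Matrix

/-- `𝒯_l` : matrices that are lower triangular with respect to the poset `I`. -/
def IsTl {I : Type*} [Fintype I] [PartialOrder I] (A : Matrix I I ℝ) : Prop :=
  ∀ j k, ¬ k ≤ j → A j k = 0

/-- `𝒯_l⁺` : lower triangular matrices with strictly positive diagonal entries. -/
def IsTlPos {I : Type*} [Fintype I] [PartialOrder I] (A : Matrix I I ℝ) : Prop :=
  IsTl A ∧ ∀ i, 0 < A i i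

/-- The homogeneous cone `𝒫 = {T·Tᵀ : T ∈ 𝒯_l⁺}`. -/
def Pset (I : Type*) [Fintype I] [PartialOrder I] : Set (Matrix I I ℝ) :=
  {S | ∃ T : Matrix I I ℝ, IsTlPos T ∧ S = T * Tᵀ}

/-- `ℋ` : symmetric matrices vanishing at incomparable pairs of indices. -/
def Hset (I : Type*) [Fintype I] [PartialOrder I] : Set (Matrix I I ℝ) :=
  {X | X.IsSymm ∧ ∀ i j : I, ¬ (i ≤ j ∨ j ≤ i) → X i j = 0}

/-- A source of a poset `I` is an element `k` such that there exist incomparable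
`i, j` with `k ≺ i` and `k ≺ j`. -/
def HasSource (I : Type*) [PartialOrder I] : Prop :=
  ∃ k i j : I, ¬ i ≤ j ∧ ¬ j ≤ i ∧ k < i ∧ k < j

/-- Without sources, any two elements with a common lower bound are comparable. -/
theorem le_or_le_of_not_hasSource {I : Type*} [PartialOrder I] (h : ¬ HasSource I)
    {k i j : I} (hi : k ≤ i) (hj : k ≤ j) : i ≤ j ∨ j ≤ i := by
  by_contra! hij
  exact h ⟨k, i, j, hij.1, hij.2, lt_of_le_of_ne hi (by rintro rfl; exact hij.1 hj),
    lt_of_le_of_ne hj (by rintro rfl; exact hij.2 hi)⟩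

theorem IsTl.mul_transpose_mem_Hset {I : Type*} [Fintype I] [PartialOrder I]
    (h : ¬ HasSource I) {T : Matrix I I ℝ} (hT : IsTl T) : T * Tᵀ ∈ Hset I := by
  refine ⟨by simp [Matrix.IsSymm], fun i j hij => ?_⟩
  rw [Matrix.mul_apply]
  refine Finset.sum_eq_zero fun k _ => ?_
  rw [Matrix.transpose_apply]
  by_cases hi : k ≤ i
  · by_cases hj : k ≤ j
    · exact absurd (le_or_le_of_not_hasSource h hi hj) hij
    · rw [hT j k hj, mul_zero]
  · rw [hT i k hi, zero_mul]

theorem IsTlPos.vecMul_injective {I : Type*} [Fintype I] [PartialOrder I]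
    {T : Matrix I I ℝ} (hT : IsTlPos T) : Function.Injective T.vecMul := by
  rw [← Matrix.coe_vecMulLinear, injective_iff_map_eq_zero]
  intro x hx
  rw [Matrix.vecMulLinear_apply] at hx
  funext k
  induction k using WellFoundedGT.induction with
  | ind k ih =>
    have hk : ∑ j, x j * T j k = 0 := congrFun hx k
    rw [Finset.sum_eq_single k] at hk
    · exact (mul_eq_zero.1 hk).resolve_right (hT.2 k).ne'
    · intro j _ hjk
      by_cases hkj : k ≤ j
      · rw [ih j (lt_of_le_of_ne hkj (Ne.symm hjk)), Pi.zero_apply, zero_mul]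
      · rw [hT.1 j k hkj, mul_zero]
    · simp

theorem IsTlPos.posDef_mul_transpose {I : Type*} [Fintype I] [PartialOrder I]
    {T : Matrix I I ℝ} (hT : IsTlPos T) : (T * Tᵀ).PosDef := by
  simpa [Matrix.conjTranspose_eq_transpose_of_trivial] using
    Matrix.PosDef.mul_conjTranspose_self T hT.vecMul_injective

/-- One step of Cholesky elimination: if `X m m = r ^ 2` and `v = r⁻¹ • X.col m`, the value of the
quadratic form of the Schur complement `X - v vᵀ` at `x` is a value of the quadratic form of `X`. -/
theorem dotProduct_sub_vecMulVec_mulVec {I : Type*} [Fintype I] [DecidableEq I]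
    {X : Matrix I I ℝ} (hX : X.IsSymm) {m : I} {r : ℝ} {v : I → ℝ} (hr : r ≠ 0)
    (hm : v m = r) (hv : ∀ i, X i m = r * v i) (x : I → ℝ) :
    x ⬝ᵥ ((X - vecMulVec v v) *ᵥ x) =
      (x - Pi.single m (v ⬝ᵥ x / r)) ⬝ᵥ (X *ᵥ (x - Pi.single m (v ⬝ᵥ x / r))) := by
  have hcol (t : ℝ) : X *ᵥ Pi.single m t = (t * r) • v := by
    ext i
    simp [Matrix.mulVec_single, hv]
    ring
  have hrow : (X *ᵥ x) m = r * (v ⬝ᵥ x) := by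
    simp only [Matrix.mulVec, dotProduct, Finset.mul_sum]
    refine Finset.sum_congr rfl fun i _ => ?_
    rw [← hX.apply, hv]
    ring
  simp only [Matrix.sub_mulVec, Matrix.mulVec_sub, hcol, sub_dotProduct, dotProduct_sub,
    single_dotProduct, Matrix.vecMulVec_mulVec, dotProduct_smul, hrow, smul_eq_mul,
    hm, dotProduct_comm x v, op_smul_eq_smul]
  field_simp
  ring

/-- Cholesky factorization along a poset, for matrices supported on a set `S` of indices. -/
theorem exists_isTl_mul_transpose_eq {I : Type*} [Fintype I] [DecidableEq I] [PartialOrder I]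
    (h : ¬ HasSource I) (S : Finset I) {X : Matrix I I ℝ} (hX : X ∈ Hset I)
    (hS : ∀ i j, i ∉ S → X i j = 0)
    (hpos : ∀ x : I → ℝ, (∀ i, i ∉ S → x i = 0) → x ≠ 0 → 0 < x ⬝ᵥ (X *ᵥ x)) :
    ∃ T : Matrix I I ℝ, IsTl T ∧ (∀ i ∈ S, 0 < T i i) ∧
      (∀ j k, j ∉ S ∨ k ∉ S → T j k = 0) ∧ X = T * Tᵀ := by
  induction hn : S.card generalizing S X with
  | zero =>
    obtain rfl := Finset.card_eq_zero.1 hn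
    refine ⟨0, fun _ _ _ => rfl, by simp, fun _ _ _ => rfl, ?_⟩
    ext i j
    simp [hS i j]
  | succ n ih =>
    obtain ⟨m, hm⟩ := S.exists_minimal (Finset.card_pos.1 (by omega))
    have hmm : 0 < X m m := by
      have := hpos (Pi.single m 1) (fun i hi => Pi.single_eq_of_ne (by
        rintro rfl; exact hi hm.prop) _) (by simp)
      simpa using this
    set r := √(X m m)
    have hr0 : 0 < r := Real.sqrt_pos.2 hmm
    have hrr : r * r = X m m := Real.mul_self_sqrt hmm.le
    set v : I → ℝ := fun i => X i m / r with hvdef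
    have hv (i) : X i m = r * v i := by simp only [hvdef]; field_simp
    have hvm : v m = r := by simp only [hvdef, ← hrr]; field_simp
    have hvS (i) (hi : i ∉ S) : v i = 0 := by simp [hvdef, hS i m hi]
    have hvle (i) (hi : ¬ m ≤ i) : v i = 0 := by
      by_cases hiS : i ∈ S
      · have : ¬ i ≤ m := fun hle => hi (hm.le_of_le hiS hle)
        simp [hvdef, hX.2 i m (by tauto)]
      · exact hvS i hiS
    have hXm (i) : X m i = r * v i := by rw [← hX.1.apply, hv]
    obtain ⟨T, hTl, hTpos, hTS, hXT⟩ := ih (S.erase m) (X := X - vecMulVec v v)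
      ⟨by
        refine hX.1.sub ?_
        simp [Matrix.IsSymm],
       fun i j hij => by
        have : v i = 0 ∨ v j = 0 := by
          by_contra! hne
          exact hij (le_or_le_of_not_hasSource h (not_imp_comm.1 (hvle i) hne.1)
            (not_imp_comm.1 (hvle j) hne.2))
        rw [Matrix.sub_apply, hX.2 i j hij, Matrix.vecMulVec_apply, mul_eq_zero.2 this, sub_zero]⟩
      (fun i j hi => by
        rw [Matrix.sub_apply, Matrix.vecMulVec_apply]
        by_cases him : i = m
        · rw [him, hXm, hvm, sub_self]
        · have hiS : i ∉ S := fun hiS => hi (Finset.mem_erase.2 ⟨him, hiS⟩)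
          rw [hS i j hiS, hvS i hiS, zero_mul, sub_zero])
      (fun x hx hx0 => by
        rw [dotProduct_sub_vecMulVec_mulVec hX.1 hr0.ne' hvm hv]
        refine hpos _ (fun i hi => ?_) fun h0 => hx0 ?_
        · have him : i ≠ m := by rintro rfl; exact hi hm.prop
          simp [him, hx i fun hi' => hi (Finset.mem_of_mem_erase hi')]
        · funext i
          by_cases him : i = m
          · rw [him, hx m (Finset.notMem_erase m S), Pi.zero_apply]
          · simpa [him] using congrFun h0 i)
      (by rw [Finset.card_erase_of_mem hm.prop, hn, Nat.add_sub_cancel])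
    have hTm (i) : T i m = 0 := hTS i m (Or.inr (Finset.notMem_erase m S))
    refine ⟨T + vecMulVec v (Pi.single m 1), fun j k hjk => ?_, fun i hi => ?_,
      fun j k hjk => ?_, ?_⟩
    · rw [Matrix.add_apply, hTl j k hjk, Matrix.vecMulVec_apply, zero_add]
      by_cases hkm : k = m
      · rw [hvle j (hkm ▸ hjk), zero_mul]
      · simp [hkm]
    · rw [Matrix.add_apply, Matrix.vecMulVec_apply]
      by_cases him : i = m
      · simpa [him, hTm, hvm] using hr0
      · simpa [him] using hTpos i (Finset.mem_erase.2 ⟨him, hi⟩)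
    · rw [Matrix.add_apply, Matrix.vecMulVec_apply,
        hTS j k (hjk.imp (mt Finset.mem_of_mem_erase) (mt Finset.mem_of_mem_erase)), zero_add]
      rcases hjk with hj | hk
      · rw [hvS j hj, zero_mul]
      · have hkm : k ≠ m := by rintro rfl; exact hk hm.prop
        simp [hkm]
    · have hTcol : T *ᵥ Pi.single m 1 = 0 := by
        ext i
        simp [hTm]
      rw [sub_eq_iff_eq_add.1 hXT]
      simp only [Matrix.transpose_add, Matrix.transpose_vecMulVec, Matrix.add_mul, Matrix.mul_add,
        Matrix.mul_vecMulVec, Matrix.vecMulVec_mul, hTcol, Matrix.vecMul_transpose]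
      ext i j
      simp [Matrix.vecMulVec_apply, hTm]

/-- If the finite poset `I` has no source, then `𝒫` is exactly the set of positive
definite matrices belonging to `ℋ`; in particular `𝒫` is stable under addition. -/
theorem Pset_eq_posDef_inter_Hset (I : Type*) [Fintype I] [DecidableEq I] [PartialOrder I]
    (h : ¬ HasSource I) :
    Pset I = {X : Matrix I I ℝ | X ∈ Hset I ∧ X.PosDef} ∧
      ∀ X ∈ Pset I, ∀ Y ∈ Pset I, X + Y ∈ Pset I := by
  have key : Pset I = {X : Matrix I I ℝ | X ∈ Hset I ∧ X.PosDef} := by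
    ext X
    constructor
    · rintro ⟨T, hT, rfl⟩
      exact ⟨hT.1.mul_transpose_mem_Hset h, hT.posDef_mul_transpose⟩
    · rintro ⟨hX, hpos⟩
      obtain ⟨T, hTl, hTpos, -, hXT⟩ := exists_isTl_mul_transpose_eq h Finset.univ hX (by simp)
        fun x _ hx => by simpa using hpos.dotProduct_mulVec_pos hx
      exact ⟨T, ⟨hTl, fun i => hTpos i (Finset.mem_univ i)⟩, hXT⟩
  refine ⟨key, fun X hX Y hY => ?_⟩
  rw [key] at hX hY ⊢
  refine ⟨⟨hX.1.1.add hY.1.1, fun i j hij => ?_⟩, hX.2.add hY.2⟩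
  rw [Matrix.add_apply, hX.1.2 i j hij, hY.1.2 i j hij, add_zero]
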